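/- Let Θ(t) := ∑_{n=1}^∞ (2π² n⁴ t^{3/2} − 3π n² t^{1/2}) e^{−π n² t} for t > 0. Then for every w ∈ ℂ with w ∉ {0, 1}, ∫₀^∞ Θ(t) t^{(w+1)/2 − 1} dt = (1/2) w (w − 1) Λ(w), where Λ(w) = π^{−w/2} Γ(w/2) ζ(w) is the completed Riemann zeta function. Equivalently, M(s) := ∫₀^∞ Θ(t) t^{s−1} dt satisfies M(s) = ξ(2s − 1) whenever 2s − 1 ∉ {0, 1}, where ξ(w) := (1/2) w (w − 1) Λ(w). -/

import Mathlib

open Real MeasureTheory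

open Filter Topology Asymptotics

/-- The sum `∑ n ^ (2 * k) * exp (-π * n ^ 2 * t)` over positive integers `n`. -/
noncomputable def thetaMoment (k : ℕ) (t : ℝ) : ℝ :=
  ∑' n : ℕ, ((n : ℝ) + 1) ^ (2 * k) * Real.exp (-π * ((n : ℝ) + 1) ^ 2 * t)

lemma thetaMoment_term_le (k n : ℕ) {t : ℝ} (ht : 0 < t) :
    ((n : ℝ) + 1) ^ (2 * k) * Real.exp (-π * ((n : ℝ) + 1) ^ 2 * t) ≤
      ((k + 1).factorial : ℝ) / t ^ (k + 1) * (1 / ((n : ℝ) + 1) ^ 2) := by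
  have hn : (0 : ℝ) < (n : ℝ) + 1 := by positivity
  have hx : 0 ≤ ((n : ℝ) + 1) ^ 2 * t := by positivity
  have h1 := Real.pow_div_factorial_le_exp _ hx (k + 1)
  have h2 : Real.exp (((n : ℝ) + 1) ^ 2 * t) ≤ Real.exp (π * ((n : ℝ) + 1) ^ 2 * t) := by
    apply Real.exp_le_exp.mpr
    nlinarith [Real.pi_gt_three]
  have h3 := h1.trans h2
  have hf : (0 : ℝ) < (k + 1).factorial := by positivity
  rw [show -π * ((n : ℝ) + 1) ^ 2 * t = -(π * ((n : ℝ) + 1) ^ 2 * t) by ring, Real.exp_neg,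
    ← div_eq_mul_inv, div_mul_div_comm, div_le_div_iff₀ (Real.exp_pos _) (by positivity)]
  rw [div_le_iff₀ hf] at h3
  calc ((n : ℝ) + 1) ^ (2 * k) * (t ^ (k + 1) * ((n : ℝ) + 1) ^ 2)
      = (((n : ℝ) + 1) ^ 2 * t) ^ (k + 1) := by rw [mul_pow, ← pow_mul]; ring
    _ ≤ _ := h3.trans (le_of_eq (by ring))

lemma summable_one_div_nat_add_one_sq : Summable fun n : ℕ ↦ 1 / ((n : ℝ) + 1) ^ 2 := by
  simpa using (summable_nat_add_iff 1).mpr (Real.summable_one_div_nat_pow.mpr one_lt_two)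

lemma hasSum_thetaMoment (k : ℕ) {t : ℝ} (ht : 0 < t) :
    HasSum (fun n : ℕ ↦ ((n : ℝ) + 1) ^ (2 * k) * Real.exp (-π * ((n : ℝ) + 1) ^ 2 * t))
      (thetaMoment k t) :=
  (Summable.of_nonneg_of_le (fun n ↦ by positivity) (fun n ↦ thetaMoment_term_le k n ht)
    (summable_one_div_nat_add_one_sq.mul_left _)).hasSum

lemma thetaMoment_nonneg (k : ℕ) (t : ℝ) : 0 ≤ thetaMoment k t :=
  tsum_nonneg fun n ↦ by positivity

lemma hasDerivAt_thetaMoment (k : ℕ) {t : ℝ} (ht : 0 < t) :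
    HasDerivAt (thetaMoment k) (-π * thetaMoment (k + 1) t) t := by
  have ht' : t ∈ Set.Ioi (t / 2) := half_lt_self ht
  have hpos {y : ℝ} (hy : y ∈ Set.Ioi (t / 2)) : 0 < y := (half_pos ht).trans hy
  have key := hasDerivAt_tsum_of_isPreconnected
    (g := fun (n : ℕ) (y : ℝ) ↦
      ((n : ℝ) + 1) ^ (2 * k) * Real.exp (-π * ((n : ℝ) + 1) ^ 2 * y))
    (g' := fun (n : ℕ) (y : ℝ) ↦
      -π * (((n : ℝ) + 1) ^ (2 * (k + 1)) * Real.exp (-π * ((n : ℝ) + 1) ^ 2 * y)))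
    ((summable_one_div_nat_add_one_sq.mul_left
      (((k + 1 + 1).factorial : ℝ) / (t / 2) ^ (k + 1 + 1))).mul_left π)
    isOpen_Ioi isPreconnected_Ioi (fun n y _ ↦ ?_) (fun n y hy ↦ ?_) ht'
    (hasSum_thetaMoment k ht).summable ht'
  · rwa [tsum_mul_left] at key
  · have h := (((hasDerivAt_id y).const_mul (-π * ((n : ℝ) + 1) ^ 2)).exp).const_mul
      (((n : ℝ) + 1) ^ (2 * k))
    refine h.congr_deriv ?_
    simp only [id, mul_one]
    ring
  · rw [norm_mul, norm_neg, Real.norm_of_nonneg pi_pos.le, Real.norm_of_nonneg (by positivity)]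
    refine mul_le_mul_of_nonneg_left ((thetaMoment_term_le (k + 1) n (hpos hy)).trans ?_) pi_pos.le
    have := (Set.mem_Ioi.mp hy).le
    gcongr

lemma continuousOn_thetaMoment (k : ℕ) : ContinuousOn (thetaMoment k) (Set.Ioi 0) :=
  fun _ ht ↦ (hasDerivAt_thetaMoment k ht).continuousAt.continuousWithinAt

lemma thetaMoment_isBigO_nhdsGT_zero (k : ℕ) :
    thetaMoment k =O[𝓝[>] 0] (· ^ (-((k : ℝ) + 1))) := by
  refine IsBigO.of_bound ((k + 1).factorial * ∑' n : ℕ, 1 / ((n : ℝ) + 1) ^ 2) ?_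
  filter_upwards [self_mem_nhdsWithin] with t (ht : 0 < t)
  rw [Real.norm_of_nonneg (thetaMoment_nonneg k t), Real.norm_of_nonneg (by positivity),
    Real.rpow_neg ht.le, ← Nat.cast_add_one, Real.rpow_natCast]
  refine (hasSum_le (fun n ↦ thetaMoment_term_le k n ht) (hasSum_thetaMoment k ht)
    (summable_one_div_nat_add_one_sq.hasSum.mul_left _)).trans (le_of_eq ?_)
  ring

lemma thetaMoment_isBigO_atTop (k : ℕ) :
    thetaMoment k =O[atTop] fun t ↦ Real.exp (-1 * t) := by
  refine IsBigO.of_bound (Real.exp 1 * thetaMoment k 1) ?_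
  filter_upwards [eventually_ge_atTop 1] with t ht
  rw [Real.norm_of_nonneg (thetaMoment_nonneg k t), Real.norm_of_nonneg (Real.exp_pos _).le]
  refine (hasSum_le (fun n ↦ ?_) (hasSum_thetaMoment k (one_pos.trans_le ht))
    ((hasSum_thetaMoment k one_pos).mul_left (Real.exp 1 * Real.exp (-1 * t)))).trans
      (le_of_eq (by ring))
  rw [mul_left_comm, ← Real.exp_add, ← Real.exp_add]
  gcongr
  have hn : (1 : ℝ) ≤ ((n : ℝ) + 1) ^ 2 := one_le_pow₀ (by linarith [n.cast_nonneg (α := ℝ)])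
  have hc : 1 ≤ π * ((n : ℝ) + 1) ^ 2 := by nlinarith [Real.pi_gt_three]
  nlinarith

lemma thetaMoment_zero_inv {t : ℝ} (ht : 0 < t) :
    1 + 2 * thetaMoment 0 t⁻¹ = √t * (1 + 2 * thetaMoment 0 t) := by
  have h {x : ℝ} (hx : 0 < x) : 1 + 2 * thetaMoment 0 x = HurwitzZeta.cosKernel 0 x := by
    have h1 := HurwitzZeta.hasSum_nat_cosKernel₀ 0 hx
    have h2 := (hasSum_thetaMoment 0 hx).mul_left 2
    have := h1.unique (by simpa using h2)
    rw [QuotientAddGroup.mk_zero] at this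
    linarith
  have hfe := HurwitzZeta.evenKernel_functional_equation 0 t
  rw [HurwitzZeta.evenKernel_eq_cosKernel_of_zero, one_div t, ← Real.sqrt_eq_rpow] at hfe
  rw [h ht, h (inv_pos.mpr ht), hfe]
  have := Real.sqrt_pos.mpr ht
  field_simp

lemma thetaMoment_one_inv {t : ℝ} (ht : 0 < t) :
    2 * π * thetaMoment 1 t⁻¹ =
      t * √t * (1 + 2 * thetaMoment 0 t) / 2 - 2 * π * (t ^ 2 * √t) * thetaMoment 1 t := by
  have hl : HasDerivAt (fun x ↦ 1 + 2 * thetaMoment 0 x⁻¹) _ t :=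
    (((hasDerivAt_thetaMoment 0 (inv_pos.mpr ht)).comp t
      (hasDerivAt_inv ht.ne')).const_mul 2).const_add 1
  have hr : HasDerivAt (fun x ↦ √x * (1 + 2 * thetaMoment 0 x)) _ t :=
    (Real.hasDerivAt_sqrt ht.ne').mul (((hasDerivAt_thetaMoment 0 ht).const_mul 2).const_add 1)
  have he : (fun x ↦ 1 + 2 * thetaMoment 0 x⁻¹) =ᶠ[𝓝 t]
      fun x ↦ √x * (1 + 2 * thetaMoment 0 x) := by
    filter_upwards [lt_mem_nhds ht] with x hx using thetaMoment_zero_inv hx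
  have h := hl.unique (hr.congr_of_eventuallyEq he)
  have hs := Real.sqrt_pos.mpr ht
  have hsq := Real.sq_sqrt ht.le
  simp only [zero_add] at h
  generalize √t = s at *
  subst hsq
  field_simp at h ⊢
  linear_combination h

lemma thetaMoment_two_inv {t : ℝ} (ht : 0 < t) :
    2 * π ^ 2 * thetaMoment 2 t⁻¹ =
      3 / 4 * (t ^ 2 * √t) * (1 + 2 * thetaMoment 0 t) - 6 * π * (t ^ 3 * √t) * thetaMoment 1 t
        + 2 * π ^ 2 * (t ^ 4 * √t) * thetaMoment 2 t := by
  have hsd := Real.hasDerivAt_sqrt ht.ne'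
  have hl : HasDerivAt (fun x ↦ 2 * π * thetaMoment 1 x⁻¹) _ t :=
    ((hasDerivAt_thetaMoment 1 (inv_pos.mpr ht)).comp t (hasDerivAt_inv ht.ne')).const_mul (2 * π)
  have hr : HasDerivAt (fun x ↦ x * √x * (1 + 2 * thetaMoment 0 x) / 2
      - 2 * π * (x ^ 2 * √x) * thetaMoment 1 x) _ t :=
    ((((hasDerivAt_id t).mul hsd).mul
      (((hasDerivAt_thetaMoment 0 ht).const_mul 2).const_add 1)).div_const 2).sub
      (((((hasDerivAt_id t).pow 2).mul hsd).const_mul (2 * π)).mul (hasDerivAt_thetaMoment 1 ht))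
  have he : (fun x ↦ 2 * π * thetaMoment 1 x⁻¹) =ᶠ[𝓝 t]
      fun x ↦ x * √x * (1 + 2 * thetaMoment 0 x) / 2
        - 2 * π * (x ^ 2 * √x) * thetaMoment 1 x := by
    filter_upwards [lt_mem_nhds ht] with x hx using thetaMoment_one_inv hx
  have h := hl.unique (hr.congr_of_eventuallyEq he)
  have hs := Real.sqrt_pos.mpr ht
  have hsq := Real.sq_sqrt ht.le
  simp only [zero_add, id, Pi.mul_apply, Pi.pow_apply, Nat.reduceAdd] at h
  generalize √t = s at *
  subst hsq
  field_simp at h ⊢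
  linear_combination h

/-- The kernel whose Mellin transform is `ξ (2 * s - 1)`. -/
noncomputable def xiKernel (t : ℝ) : ℝ :=
  2 * π ^ 2 * t ^ ((3 : ℝ) / 2) * thetaMoment 2 t - 3 * π * t ^ ((1 : ℝ) / 2) * thetaMoment 1 t

lemma rpow_three_halves {t : ℝ} (ht : 0 < t) : t ^ ((3 : ℝ) / 2) = t * √t := by
  rw [Real.sqrt_eq_rpow, show (3 : ℝ) / 2 = 1 + 1 / 2 by norm_num, Real.rpow_add ht, Real.rpow_one]

lemma xiKernel_inv {t : ℝ} (ht : 0 < t) :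
    xiKernel t⁻¹ = t ^ ((3 : ℝ) / 2) * xiKernel t := by
  have h1 := thetaMoment_one_inv ht
  have h2 := thetaMoment_two_inv ht
  rw [xiKernel, xiKernel, rpow_three_halves ht, rpow_three_halves (inv_pos.mpr ht),
    ← Real.sqrt_eq_rpow, ← Real.sqrt_eq_rpow, Real.sqrt_inv]
  have hs := Real.sqrt_pos.mpr ht
  have hsq := Real.sq_sqrt ht.le
  generalize √t = s at *
  subst hsq
  generalize thetaMoment 1 (s ^ 2)⁻¹ = a at *
  generalize thetaMoment 2 (s ^ 2)⁻¹ = b at *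
  linear_combination (norm := (field_simp; ring)) (s ^ 2)⁻¹ * s⁻¹ * h2 - 3 / 2 * s⁻¹ * h1

lemma continuousOn_xiKernel : ContinuousOn xiKernel (Set.Ioi 0) := by
  have hp (r : ℝ) : ContinuousOn (fun t : ℝ ↦ t ^ r) (Set.Ioi 0) := fun t ht ↦
    (Real.continuousAt_rpow_const t r (Or.inl (ne_of_gt ht))).continuousWithinAt
  exact ((continuousOn_const.mul (hp _)).mul (continuousOn_thetaMoment 2)).sub
    ((continuousOn_const.mul (hp _)).mul (continuousOn_thetaMoment 1))

lemma xiKernel_isBigO_atTop (r : ℝ) : xiKernel =O[atTop] (· ^ r) := by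
  have h (k : ℕ) (c p : ℝ) : (fun t ↦ c * t ^ p * thetaMoment k t) =O[atTop] (· ^ r) := by
    have h1 : thetaMoment k =O[atTop] (· ^ (r - p)) :=
      (thetaMoment_isBigO_atTop k).trans (isLittleO_exp_neg_mul_rpow_atTop one_pos _).isBigO
    refine ((((isBigO_refl (fun t : ℝ ↦ t ^ p) atTop).const_mul_left c)).mul h1).trans_eventuallyEq
      ?_
    filter_upwards [eventually_gt_atTop 0] with t ht
    rw [← Real.rpow_add ht, add_sub_cancel]
  exact (h 2 _ _).sub (h 1 _ _)

/-- The strong functional equation pair given by `xiKernel`. -/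
noncomputable def xiKernelFEPair : WeakFEPair ℂ where
  f t := xiKernel t
  g t := xiKernel t
  k := 3 / 2
  ε := 1
  f₀ := 0
  g₀ := 0
  hf_int := (Complex.continuous_ofReal.comp_continuousOn
    continuousOn_xiKernel).locallyIntegrableOn measurableSet_Ioi
  hg_int := (Complex.continuous_ofReal.comp_continuousOn
    continuousOn_xiKernel).locallyIntegrableOn measurableSet_Ioi
  hk := by norm_num
  hε := one_ne_zero
  h_feq x hx := by rw [one_div, xiKernel_inv hx]; simp
  hf_top r := by
    simpa only [sub_zero, Complex.isBigO_ofReal_left] using xiKernel_isBigO_atTop r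
  hg_top r := by
    simpa only [sub_zero, Complex.isBigO_ofReal_left] using xiKernel_isBigO_atTop r

lemma differentiable_mellin_xiKernel : Differentiable ℂ (mellin fun t ↦ (xiKernel t : ℂ)) := by
  have hP : IsStrongFEPair xiKernelFEPair := ⟨rfl, rfl⟩
  exact hP.Λ_eq ▸ hP.differentiable_Λ

lemma mellinConvergent_thetaMoment (k : ℕ) {z : ℂ} (hz : k + 1 < z.re) :
    MellinConvergent (fun t ↦ (thetaMoment k t : ℂ)) z :=
  mellinConvergent_of_isBigO_rpow_exp one_pos
    ((Complex.continuous_ofReal.comp_continuousOn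
      (continuousOn_thetaMoment k)).locallyIntegrableOn measurableSet_Ioi)
    (Complex.isBigO_ofReal_left.mpr (thetaMoment_isBigO_atTop k))
    (Complex.isBigO_ofReal_left.mpr (thetaMoment_isBigO_nhdsGT_zero k)) hz

lemma mellin_thetaMoment (k : ℕ) {z : ℂ} (hz : k + 1 < z.re) :
    mellin (fun t ↦ (thetaMoment k t : ℂ)) z =
      (π : ℂ) ^ (-z) * Complex.Gamma z * riemannZeta (2 * z - 2 * k) := by
  have hk : (0 : ℝ) ≤ k := k.cast_nonneg
  have hpos (n : ℕ) : (0 : ℝ) < (n : ℝ) + 1 := by positivity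
  have h := hasSum_mellin_pi_mul (a := fun n : ℕ ↦ (((n : ℝ) + 1 : ℝ) : ℂ) ^ (2 * k))
    (q := fun n : ℕ ↦ ((n : ℝ) + 1) ^ 2) (F := fun t ↦ (thetaMoment k t : ℂ)) (s := z)
    (fun n ↦ Or.inr (pow_pos (hpos n) 2)) (by linarith) (fun t ht ↦ ?_) ?_
  · rw [← h.tsum_eq, zeta_eq_tsum_one_div_nat_add_one_cpow, ← tsum_mul_left]
    · congr 1 with n
      have hn : (((n : ℝ) + 1 : ℝ) : ℂ) ≠ 0 := Complex.ofReal_ne_zero.mpr (hpos n).ne'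
      have e1 : (((((n : ℝ) + 1) ^ 2 : ℝ) : ℂ)) ^ z = (((n : ℝ) + 1 : ℝ) : ℂ) ^ (2 * z) := by
        rw [pow_two, Complex.ofReal_mul, Complex.mul_cpow_ofReal_nonneg (hpos n).le (hpos n).le,
          ← Complex.cpow_add _ _ hn, two_mul]
      have e2 : (n : ℂ) + 1 = (((n : ℝ) + 1 : ℝ) : ℂ) := by push_cast; rfl
      have e3 : (((n : ℝ) + 1 : ℝ) : ℂ) ^ (2 * (k : ℂ)) = (((n : ℝ) + 1 : ℝ) : ℂ) ^ (2 * k) := by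
        rw [← Complex.cpow_natCast]; push_cast; rfl
      rw [e1, e2, Complex.cpow_sub _ _ hn, e3, one_div_div, mul_div_assoc]
    · have : (2 * z - 2 * k : ℂ).re = 2 * z.re - 2 * k := by simp
      rw [this]
      linarith
  · simpa using Complex.hasSum_ofReal.mpr (hasSum_thetaMoment k ht)
  · have hs : Summable fun n : ℕ ↦ 1 / ((n : ℝ) + 1) ^ (2 * z.re - 2 * k) := by
      simpa using (summable_nat_add_iff 1).mpr
        (Real.summable_one_div_nat_rpow.mpr (show 1 < 2 * z.re - 2 * k by linarith))
    refine hs.congr fun n ↦ ?_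
    rw [norm_pow, Complex.norm_real, Real.norm_of_nonneg (hpos n).le, ← Real.rpow_natCast_mul
      (hpos n).le, Real.rpow_sub (hpos n), one_div_div]
    congr 1
    rw [← Real.rpow_natCast]
    push_cast
    rfl

/-- The entire function equal to `w * (w - 1) * Λ(w) / 2` away from `w = 0, 1`. -/
noncomputable def entireXi (w : ℂ) : ℂ := (w * (w - 1) * completedRiemannZeta₀ w + 1) / 2

lemma entireXi_eq {w : ℂ} (h0 : w ≠ 0) (h1 : w ≠ 1) :
    entireXi w = 1 / 2 * w * (w - 1) * completedRiemannZeta w := by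
  have : 1 - w ≠ 0 := sub_ne_zero.mpr h1.symm
  rw [entireXi, completedRiemannZeta_eq]
  field_simp
  ring

lemma differentiable_entireXi : Differentiable ℂ entireXi := by
  have := differentiable_completedZeta₀
  unfold entireXi
  fun_prop

lemma mellin_xiKernel_of_lt_re {s : ℂ} (hs : 3 / 2 < s.re) :
    mellin (fun t ↦ (xiKernel t : ℂ)) s = entireXi (2 * s - 1) := by
  have hr (a : ℝ) : (s + a).re = s.re + a := by simp
  have hz2 : ((2 : ℕ) : ℝ) + 1 < (s + (3 / 2 : ℝ)).re := by rw [hr]; push_cast; linarith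
  have hz1 : ((1 : ℕ) : ℝ) + 1 < (s + (1 / 2 : ℝ)).re := by rw [hr]; push_cast; linarith
  have c2 := (MellinConvergent.cpow_smul.mpr (mellinConvergent_thetaMoment 2 hz2)).const_smul
    (2 * π ^ 2 : ℂ)
  have c1 := (MellinConvergent.cpow_smul.mpr (mellinConvergent_thetaMoment 1 hz1)).const_smul
    (3 * π : ℂ)
  have hm := (hasMellin_sub c2 c1).2
  rw [mellin_const_smul, mellin_const_smul, mellin_cpow_smul, mellin_cpow_smul,
    mellin_thetaMoment 2 hz2, mellin_thetaMoment 1 hz1] at hm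
  have hwre : (2 * s - 1).re = 2 * s.re - 1 := by simp
  have hw0 : 2 * s - 1 ≠ 0 := fun h ↦ by rw [h, Complex.zero_re] at hwre; linarith
  have hw1 : 2 * s - 1 ≠ 1 := fun h ↦ by rw [h, Complex.one_re] at hwre; linarith
  have hG : s - 1 / 2 ≠ 0 := fun h ↦ hw0 (by linear_combination 2 * h)
  have hG' : s + 1 / 2 ≠ 0 := fun h ↦ by
    have := congrArg Complex.re h
    simp at this
    linarith
  have hΓ : Complex.Gammaℝ (2 * s - 1) ≠ 0 :=
    Complex.Gammaℝ_ne_zero_of_re_pos (by rw [hwre]; linarith)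
  have hΛ : completedRiemannZeta (2 * s - 1) =
      (π : ℂ) ^ (-(s - 1 / 2)) * Complex.Gamma (s - 1 / 2) * riemannZeta (2 * s - 1) := by
    rw [riemannZeta_def_of_ne_zero hw0]
    have : (π : ℂ) ^ (-(s - 1 / 2)) * Complex.Gamma (s - 1 / 2) = Complex.Gammaℝ (2 * s - 1) := by
      rw [Complex.Gammaℝ_def]
      ring_nf
    rw [this, mul_div_cancel₀ _ hΓ]
  rw [entireXi_eq hw0 hw1, hΛ]
  have hπ : (π : ℂ) ≠ 0 := Complex.ofReal_ne_zero.mpr pi_ne_zero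
  have p1 : (π : ℂ) ^ (-(s - 1 / 2)) = (π : ℂ) ^ (-(s + 1 / 2)) * π := by
    nth_rw 3 [← Complex.cpow_one (π : ℂ)]; rw [← Complex.cpow_add _ _ hπ]; ring_nf
  have p2 : (π : ℂ) ^ (-(s + 1 / 2)) = (π : ℂ) ^ (-(s + 3 / 2)) * π := by
    nth_rw 3 [← Complex.cpow_one (π : ℂ)]; rw [← Complex.cpow_add _ _ hπ]; ring_nf
  have g1 : Complex.Gamma (s + 1 / 2) = (s - 1 / 2) * Complex.Gamma (s - 1 / 2) := by
    rw [← Complex.Gamma_add_one _ hG]; ring_nf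
  have g2 : Complex.Gamma (s + 3 / 2) = (s + 1 / 2) * Complex.Gamma (s + 1 / 2) := by
    rw [← Complex.Gamma_add_one _ hG']; ring_nf
  have e2 : 2 * (s + (3 / 2 : ℝ)) - 2 * ((2 : ℕ) : ℂ) = 2 * s - 1 := by push_cast; ring
  have e1 : 2 * (s + (1 / 2 : ℝ)) - 2 * ((1 : ℕ) : ℂ) = 2 * s - 1 := by push_cast; ring
  rw [e1, e2] at hm
  push_cast at hm
  rw [g2, g1, p2] at hm
  rw [p1, p2]
  trans (mellin (fun t ↦ (2 * π ^ 2 : ℂ) • (t : ℂ) ^ (3 / 2 : ℂ) • (thetaMoment 2 t : ℂ) -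
    (3 * π : ℂ) • (t : ℂ) ^ (1 / 2 : ℂ) • (thetaMoment 1 t : ℂ)) s)
  · refine setIntegral_congr_fun measurableSet_Ioi fun t (ht : 0 < t) ↦ ?_
    simp only [xiKernel, smul_eq_mul]
    push_cast [Complex.ofReal_cpow ht.le]
    ring
  · rw [hm]
    simp only [smul_eq_mul]
    ring

lemma mellin_xiKernel (s : ℂ) :
    mellin (fun t ↦ (xiKernel t : ℂ)) s = entireXi (2 * s - 1) := by
  have h1 : AnalyticOnNhd ℂ (mellin fun t ↦ (xiKernel t : ℂ)) Set.univ :=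
    fun z _ ↦ differentiable_mellin_xiKernel.analyticAt z
  have h2 : AnalyticOnNhd ℂ (fun s ↦ entireXi (2 * s - 1)) Set.univ := by
    have : Differentiable ℂ fun s ↦ entireXi (2 * s - 1) :=
      differentiable_entireXi.comp (by fun_prop)
    exact fun z _ ↦ this.analyticAt z
  have h3 : (mellin fun t ↦ (xiKernel t : ℂ)) =ᶠ[𝓝 2] fun s ↦ entireXi (2 * s - 1) := by
    filter_upwards [(isOpen_lt continuous_const Complex.continuous_re).mem_nhds
      (show (3 / 2 : ℝ) < (2 : ℂ).re by norm_num)] with z hz using mellin_xiKernel_of_lt_re hz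
  exact congrFun (h1.eq_of_eventuallyEq h2 h3) s

/-- the Mellin transform of `Θ` equals `ξ(2s−1)`, where
`ξ(w) := (1/2) w (w−1) Λ(w)` and `Λ` is the completed Riemann zeta function. -/
theorem stmt_16
    (Θ : ℝ → ℝ)
    (hΘ : ∀ t : ℝ, Θ t = ∑' n : ℕ,
      (2 * π ^ 2 * ((n : ℝ) + 1) ^ 4 * t ^ ((3 : ℝ) / 2)
        - 3 * π * ((n : ℝ) + 1) ^ 2 * t ^ ((1 : ℝ) / 2))
        * Real.exp (-π * ((n : ℝ) + 1) ^ 2 * t))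
    (ξ : ℂ → ℂ)
    (hξ : ∀ w : ℂ, ξ w = (1 / 2) * w * (w - 1) * completedRiemannZeta w) :
    (∀ w : ℂ, w ≠ 0 → w ≠ 1 →
      ∫ t in Set.Ioi (0 : ℝ), (Θ t : ℂ) * (t : ℂ) ^ ((w + 1) / 2 - 1) = ξ w) ∧
    (∀ s : ℂ, 2 * s - 1 ≠ 0 → 2 * s - 1 ≠ 1 →
      ∫ t in Set.Ioi (0 : ℝ), (Θ t : ℂ) * (t : ℂ) ^ (s - 1) = ξ (2 * s - 1)) := by
  have hΘ' {t : ℝ} (ht : 0 < t) : Θ t = xiKernel t := by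
    rw [hΘ, xiKernel, ← ((((hasSum_thetaMoment 2 ht).mul_left _).sub
      ((hasSum_thetaMoment 1 ht).mul_left _))).tsum_eq]
    congr 1 with n
    ring
  have main (s : ℂ) (h0 : 2 * s - 1 ≠ 0) (h1 : 2 * s - 1 ≠ 1) :
      ∫ t in Set.Ioi (0 : ℝ), (Θ t : ℂ) * (t : ℂ) ^ (s - 1) = ξ (2 * s - 1) := by
    rw [hξ, ← entireXi_eq h0 h1, ← mellin_xiKernel, mellin]
    refine setIntegral_congr_fun measurableSet_Ioi fun t ht ↦ ?_
    simp only [hΘ' ht, smul_eq_mul, mul_comm]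
  refine ⟨fun w h0 h1 ↦ ?_, main⟩
  have hw : 2 * ((w + 1) / 2) - 1 = w := by ring
  simpa only [hw] using main ((w + 1) / 2) (hw.symm ▸ h0) (hw.symm ▸ h1)
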